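/- Let f : ℕ → ℂ be in the class F₁. Then Σ_{n₁,n₂ ≤ x} f(gcd(n₁,n₂)) = x²·log log x + D̄_{f,2}·x² + O( x² / log x ) as x → ∞, where D̄_{f,2} = γ + Σ_p ( log(1 − 1/p) + (1 − 1/p²)·Σ_{ν=1}^{∞} f(p^ν)/p^{2ν} ) (the sum over all primes, absolutely convergent), and the sum Σ_{n₁,n₂ ≤ x} ranges over all pairs of positive integers n₁, n₂ ≤ x. -/

import Mathlib

lemma log_fact (n : ℕ) : Real.log (n.factorial : ℝ) =
    ∑ p ∈ (Finset.Icc 1 n).filter Nat.Prime, (n.factorial.factorization p : ℝ) * Real.log p := by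
  conv_lhs => rw [← Nat.prod_factorization_pow_eq_self (Nat.factorial_ne_zero n)]
  rw [Finsupp.prod_of_support_subset (s := (Finset.Icc 1 n).filter Nat.Prime)]
  · push_cast
    rw [Real.log_prod]
    · refine Finset.sum_congr rfl fun p hp => ?_
      rw [Real.log_pow]
    · intro p hp
      have := (Finset.mem_filter.1 hp).2.pos
      positivity
  · intro p hp
    simp only [Nat.support_factorization, Nat.mem_primeFactors] at hp
    have := (hp.1.dvd_factorial).1 hp.2.1
    simp only [Finset.mem_filter, Finset.mem_Icc]
    exact ⟨⟨hp.1.pos, this⟩, hp.1⟩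
  · intro i _
    simp

lemma mertens1 : ∃ K : ℝ, ∀ n : ℕ, 1 ≤ n →
    |(∑ k ∈ Finset.Icc 1 n, if k.Prime then Real.log k / k else 0) - Real.log n| ≤ K := by
  have hsum : Summable (fun k : ℕ => 4 * ((k : ℝ) ^ (-(3/2) : ℝ))) :=
    (Real.summable_nat_rpow.2 (by norm_num)).mul_left 4
  refine ⟨Real.log 4 + 1 + ∑' k : ℕ, 4 * ((k : ℝ) ^ (-(3/2) : ℝ)), fun n hn => ?_⟩
  have hn0 : (0 : ℝ) < n := by exact_mod_cast hn
  have hS0 : 0 ≤ ∑' k : ℕ, 4 * ((k : ℝ) ^ (-(3/2) : ℝ)) := tsum_nonneg fun k => by positivity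
  have hl4 : 0 ≤ Real.log 4 := Real.log_nonneg (by norm_num)
  rw [← Finset.sum_filter]
  set P := (Finset.Icc 1 n).filter Nat.Prime with hP
  have hlow : (n : ℝ) * Real.log n - n ≤ Real.log (n.factorial : ℝ) := by
    have := Stirling.le_log_factorial_stirling (n := n) (by omega)
    have h1 : 0 ≤ Real.log n := Real.log_natCast_nonneg n
    have h2 : 0 ≤ Real.log (2 * Real.pi) := Real.log_nonneg (by nlinarith [Real.pi_gt_three])
    linarith
  have hup : Real.log (n.factorial : ℝ) ≤ n * Real.log n := by
    rw [← Real.log_pow]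
    apply Real.log_le_log (by positivity)
    exact_mod_cast Nat.factorial_le_pow n
  have htheta : ∑ p ∈ P, Real.log p ≤ Real.log 4 * n := by
    have := Chebyshev.theta_le_log4_mul_x (x := n) hn0.le
    rw [Chebyshev.theta_eq_sum_Icc, Nat.floor_natCast] at this
    refine le_trans (Finset.sum_le_sum_of_subset_of_nonneg ?_ ?_) this
    · intro p hp
      simp [hP] at hp ⊢
      exact ⟨hp.1.2, hp.2⟩
    · intro i _ _
      exact Real.log_natCast_nonneg i
  have hfac := log_fact n
  rw [← hP] at hfac
  -- lower valuation
  have hv1 : ∑ p ∈ P, ((n : ℝ) / p - 1) * Real.log p ≤ Real.log (n.factorial : ℝ) := by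
    rw [hfac]
    refine Finset.sum_le_sum fun p hp => ?_
    refine mul_le_mul_of_nonneg_right ?_ (Real.log_natCast_nonneg p)
    have hpp : p.Prime := (Finset.mem_filter.1 hp).2
    have h1 : n / p ≤ n.factorial.factorization p := by
      rw [Nat.factorization_factorial hpp (b := Nat.log p n + 2) (by omega)]
      have : n / p = n / p ^ 1 := by simp
      rw [this]
      exact Finset.single_le_sum (f := fun i => n / p ^ i) (fun _ _ => Nat.zero_le _)
        (by simp)
    have h2 : (n : ℝ) / p < (n / p : ℕ) + 1 := by
      rw [← Nat.floor_div_eq_div (K := ℝ)]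
      exact Nat.lt_floor_add_one _
    have h3 : ((n / p : ℕ) : ℝ) ≤ n.factorial.factorization p := by exact_mod_cast h1
    linarith
  have hv2 : Real.log (n.factorial : ℝ) ≤
      ∑ p ∈ P, (n : ℝ) * (Real.log p / p + 4 * ((p : ℝ) ^ (-(3/2) : ℝ))) := by
    rw [hfac]
    refine Finset.sum_le_sum fun p hp => ?_
    have hpp : p.Prime := (Finset.mem_filter.1 hp).2
    have hp2 : (2 : ℝ) ≤ p := by exact_mod_cast hpp.two_le
    have h1 := Nat.factorization_factorial_le_div_pred hpp n
    have h2 : ((n.factorial.factorization p : ℕ) : ℝ) ≤ n / (p - 1) := by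
      have h3 : ((n.factorial.factorization p : ℕ) : ℝ) ≤ ((n / (p - 1) : ℕ) : ℝ) := by
        exact_mod_cast h1
      refine h3.trans (Nat.cast_div_le.trans ?_)
      rw [Nat.cast_sub hpp.one_le]; simp
    have hl : Real.log p ≤ 2 * (p : ℝ) ^ (1/2 : ℝ) := by
      have := Real.log_le_rpow_div (x := p) (by positivity) (ε := 1/2) (by norm_num)
      linarith
    have hl0 := Real.log_natCast_nonneg p
    have hpm : (p : ℝ) ^ (-(3/2) : ℝ) = (p : ℝ) ^ (1/2 : ℝ) / p ^ 2 := by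
      rw [← Real.rpow_natCast, ← Real.rpow_sub (by linarith)]; norm_num
    calc _ ≤ (n : ℝ) / (p - 1) * Real.log p := mul_le_mul_of_nonneg_right h2 hl0
      _ = n * (Real.log p / p + Real.log p / (p * (p - 1))) := by
        have : (p : ℝ) - 1 ≠ 0 := by linarith
        field_simp
        ring
      _ ≤ _ := by
        refine mul_le_mul_of_nonneg_left (add_le_add_right ?_ _) hn0.le
        rw [hpm]
        calc Real.log p / (p * (p - 1)) ≤ (2 * (p : ℝ) ^ (1/2 : ℝ)) / (p ^ 2 / 2) := by
              apply div_le_div₀ (by positivity) hl (by positivity) (by nlinarith)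
          _ = _ := by field_simp; norm_num
  have hs2 : ∑ p ∈ P, 4 * ((p : ℝ) ^ (-(3/2) : ℝ)) ≤ ∑' k : ℕ, 4 * ((k : ℝ) ^ (-(3/2) : ℝ)) :=
    hsum.sum_le_tsum _ fun k _ => by positivity
  rw [← Finset.mul_sum, Finset.sum_add_distrib] at hv2
  have e1 : ∑ p ∈ P, ((n : ℝ) / p - 1) * Real.log p =
      n * ∑ p ∈ P, Real.log p / p - ∑ p ∈ P, Real.log p := by
    rw [Finset.mul_sum, ← Finset.sum_sub_distrib]
    refine Finset.sum_congr rfl fun p _ => ?_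
    ring
  rw [e1] at hv1
  set A := ∑ p ∈ P, Real.log p / p
  set T := ∑' k : ℕ, 4 * ((k : ℝ) ^ (-(3/2) : ℝ))
  set U := ∑ p ∈ P, 4 * ((p : ℝ) ^ (-(3/2) : ℝ))
  have a1 : A ≤ Real.log n + Real.log 4 := by
    refine le_of_mul_le_mul_left ?_ hn0
    linarith
  have a2 : Real.log n - 1 ≤ A + U := by
    refine le_of_mul_le_mul_left ?_ hn0
    linarith
  rw [abs_le]; constructor <;> linarith

lemma lim_of_step (u s : ℕ → ℝ) (hs : Filter.Tendsto s Filter.atTop (nhds 0))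
    (h : ∀ n, 2 ≤ n → |u (n + 1) - u n| ≤ s n - s (n + 1)) :
    ∃ L : ℝ, ∀ n, 2 ≤ n → |u n - L| ≤ s n := by
  have key : ∀ n, 2 ≤ n → ∀ m, n ≤ m → |u m - u n| ≤ s n - s m := by
    intro n hn m hm
    induction m, hm using Nat.le_induction with
    | base => simp
    | succ m hm ih =>
      have := h m (hn.trans hm)
      calc |u (m + 1) - u n| = |(u (m + 1) - u m) + (u m - u n)| := by ring_nf
        _ ≤ _ := abs_add_le _ _
        _ ≤ _ := by linarith
  obtain ⟨L, hL⟩ : ∃ L, Filter.Tendsto u Filter.atTop (nhds L) := by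
    have ha : Antitone (fun n => u (n + 2) + s (n + 2)) := antitone_nat_of_succ_le fun n => by
      have := (abs_le.1 (h (n + 2) (by omega))).2
      have e : n + 1 + 2 = n + 2 + 1 := by ring
      rw [e]
      linarith
    have hb : BddBelow (Set.range (fun n => u (n + 2) + s (n + 2))) := by
      obtain ⟨c, hc⟩ := hs.bddBelow_range
      refine ⟨u 2 - s 2 + 2 * c, ?_⟩
      rintro _ ⟨n, rfl⟩
      have := (abs_le.1 (key 2 le_rfl (n + 2) (by omega))).1
      have h2 := hc ⟨n + 2, rfl⟩
      simp only
      linarith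
    have t := tendsto_atTop_ciInf ha hb
    have t2 := t.sub (hs.comp (Filter.tendsto_add_atTop_nat 2))
    refine ⟨_, (Filter.tendsto_add_atTop_iff_nat 2).1 (t2.congr fun n => ?_)⟩
    simp
  refine ⟨L, fun n hn => ?_⟩
  have t1 : Filter.Tendsto (fun m => |u m - u n|) Filter.atTop (nhds |L - u n|) :=
    (hL.sub_const _).abs
  have t2 : Filter.Tendsto (fun m => s n - s m) Filter.atTop (nhds (s n - 0)) := hs.const_sub _
  rw [abs_sub_comm]
  rw [sub_zero] at t2
  exact le_of_tendsto_of_tendsto t1 t2 (Filter.eventually_atTop.2 ⟨n, fun m hm => key n hn m hm⟩)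

lemma mertens2_nat : ∃ L C : ℝ, 0 ≤ C ∧ ∀ n : ℕ, 2 ≤ n →
    |(∑ k ∈ Finset.Icc 1 n, if k.Prime then (1 : ℝ) / k else 0) - Real.log (Real.log n) - L|
      ≤ C / Real.log n := by
  obtain ⟨K, hK⟩ := mertens1
  have hK0 : 0 ≤ K := (abs_nonneg _).trans (hK 1 le_rfl)
  set A : ℕ → ℝ := fun n => ∑ k ∈ Finset.Icc 1 n, if k.Prime then Real.log k / k else 0 with hA
  set B : ℕ → ℝ := fun n => ∑ k ∈ Finset.Icc 1 n, if k.Prime then (1 : ℝ) / k else 0 with hB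
  have hlogt : Filter.Tendsto (fun n : ℕ => Real.log n) Filter.atTop Filter.atTop :=
    Real.tendsto_log_atTop.comp tendsto_natCast_atTop_atTop
  obtain ⟨L, hL⟩ := lim_of_step
    (fun n => B n - Real.log (Real.log n) - (A n - Real.log n) / Real.log n)
    (fun n => (K + 1) / Real.log n) (hlogt.const_div_atTop _) (by
      intro n hn
      have hn2 : (2 : ℝ) ≤ n := by exact_mod_cast hn
      have hv : 0 < Real.log n := Real.log_pos (by linarith)
      have hvw : Real.log n ≤ Real.log (n + 1 : ℕ) :=
        Real.log_le_log (by linarith) (by push_cast; linarith)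
      have hw1 : Real.log (n + 1 : ℕ) - Real.log n ≤ 1 := by
        rw [← Real.log_div (by positivity) (by positivity)]
        refine (Real.log_le_sub_one_of_pos (by positivity)).trans ?_
        push_cast
        rw [sub_le_iff_le_add, div_le_iff₀ (by positivity)]
        linarith
      have hR := hK n (by omega)
      change |A n - Real.log n| ≤ K at hR
      have eA : A (n + 1) = A n + if (n + 1).Prime then Real.log (n + 1 : ℕ) / (n + 1 : ℕ) else 0 := by
        simp only [hA]
        rw [Finset.sum_Icc_succ_top (by omega)]
      have eB : B (n + 1) = B n + if (n + 1).Prime then 1 / ((n + 1 : ℕ) : ℝ) else 0 := by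
        simp only [hB]
        rw [Finset.sum_Icc_succ_top (by omega)]
      have hw : 0 < Real.log (n + 1 : ℕ) := by linarith
      have hab : (if (n + 1).Prime then 1 / ((n + 1 : ℕ) : ℝ) else 0) =
          (if (n + 1).Prime then Real.log (n + 1 : ℕ) / (n + 1 : ℕ) else 0) / Real.log (n + 1 : ℕ) := by
        split_ifs
        · field_simp
        · simp
      rw [eA, eB, hab]
      generalize (if (n + 1).Prime then Real.log (n + 1 : ℕ) / (n + 1 : ℕ) else 0) = a
      generalize A n = x at *
      generalize B n = y at *
      generalize Real.log (n + 1 : ℕ) = w at *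
      generalize Real.log n = v at *
      have l1 : Real.log w - Real.log v ≤ (w - v) / v := by
        rw [← Real.log_div hw.ne' hv.ne']
        refine (Real.log_le_sub_one_of_pos (by positivity)).trans (le_of_eq ?_)
        field_simp
      have l2 : (w - v) / w ≤ Real.log w - Real.log v := by
        rw [← Real.log_div hw.ne' hv.ne']
        have := Real.one_sub_inv_le_log_of_pos (x := w / v) (by positivity)
        refine le_trans (le_of_eq ?_) this
        field_simp
      have hd : 0 ≤ 1 / v - 1 / w := by
        rw [sub_nonneg]
        exact one_div_le_one_div_of_le hv hvw
      have e : y + a / w - Real.log w - (x + a - w) / w - (y - Real.log v - (x - v) / v) =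
          (x - v) * (1 / v - 1 / w) + ((w - v) / w - (Real.log w - Real.log v)) := by
        field_simp
        ring
      rw [e]
      have b1 : |(x - v) * (1 / v - 1 / w)| ≤ K * (1 / v - 1 / w) := by
        rw [abs_mul, abs_of_nonneg hd]
        exact mul_le_mul_of_nonneg_right hR hd
      have b2 : |(w - v) / w - (Real.log w - Real.log v)| ≤ 1 / v - 1 / w := by
        rw [abs_le]
        constructor
        · have : (w - v) / v - (w - v) / w = (w - v) * (1 / v - 1 / w) := by ring
          nlinarith
        · linarith
      refine (abs_add_le _ _).trans ((add_le_add b1 b2).trans (le_of_eq ?_))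
      ring)
  refine ⟨L, 2 * K + 1, by linarith, fun n hn => ?_⟩
  have hn2 : (2 : ℝ) ≤ n := by exact_mod_cast hn
  have hv : 0 < Real.log n := Real.log_pos (by linarith)
  have h1 := hL n hn
  have h2 := hK n (by omega)
  change |A n - Real.log n| ≤ K at h2
  change |B n - _ - _| ≤ _
  have h3 : |(A n - Real.log n) / Real.log n| ≤ K / Real.log n := by
    rw [abs_div, abs_of_pos hv]
    gcongr
  have := (abs_add_le _ _).trans (add_le_add h1 h3)
  refine le_trans (le_of_eq ?_) (this.trans (le_of_eq ?_))
  · congr 1; ring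
  · ring

lemma mertens2_real : ∃ L C : ℝ, 0 ≤ C ∧ ∀ x : ℝ, 2 ≤ x →
    |(∑ k ∈ Finset.Icc 1 ⌊x⌋₊, if k.Prime then (1 : ℝ) / k else 0) - Real.log (Real.log x) - L|
      ≤ C / Real.log x := by
  obtain ⟨L, C, hC, h⟩ := mertens2_nat
  refine ⟨L, 2 * C + 2, by linarith, fun x hx => ?_⟩
  have hN : 2 ≤ ⌊x⌋₊ := Nat.le_floor (by exact_mod_cast hx)
  have h1 := h _ hN
  have hf1 := Nat.floor_le (a := x) (by linarith)
  have hf2 := Nat.lt_floor_add_one x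
  generalize ⌊x⌋₊ = N at *
  have hN2 : (2 : ℝ) ≤ N := by exact_mod_cast hN
  have hv : 0 < Real.log N := Real.log_pos (by linarith)
  have hw : 0 < Real.log x := Real.log_pos (by linarith)
  have hvw : Real.log N ≤ Real.log x := Real.log_le_log (by linarith) hf1
  have hw1 : Real.log x - Real.log N ≤ 1 := by
    rw [← Real.log_div (by positivity) (by positivity)]
    refine (Real.log_le_sub_one_of_pos (by positivity)).trans ?_
    rw [sub_le_iff_le_add, div_le_iff₀ (by positivity)]
    linarith
  have h2 : Real.log x ≤ 2 * Real.log N := by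
    have : Real.log x ≤ Real.log ((N : ℝ) ^ 2) := Real.log_le_log (by linarith) (by nlinarith)
    rw [Real.log_pow] at this
    exact_mod_cast this
  have h3 : 1 / Real.log N ≤ 2 / Real.log x := by
    rw [div_le_div_iff₀ hv hw]; linarith
  have l1 : Real.log (Real.log x) - Real.log (Real.log N) ≤ 1 / Real.log N := by
    rw [← Real.log_div hw.ne' hv.ne']
    refine (Real.log_le_sub_one_of_pos (by positivity)).trans ?_
    rw [sub_le_iff_le_add, div_le_iff₀ hv]
    field_simp
    linarith
  have l2 : Real.log (Real.log N) ≤ Real.log (Real.log x) := Real.log_le_log hv hvw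
  have h4 : C / Real.log N ≤ 2 * C / Real.log x := by
    have := mul_le_mul_of_nonneg_left h3 hC
    calc _ = C * (1 / Real.log N) := by ring
      _ ≤ _ := this
      _ = _ := by ring
  have h5 : (2 * C + 2) / Real.log x = 2 * C / Real.log x + 2 / Real.log x := by ring
  rw [h5]
  rw [abs_le] at h1 ⊢
  constructor <;> linarith [h1.1, h1.2]

open MeasureTheory in
lemma integral_log_exp : ∫ u in Set.Ioi (0 : ℝ), Real.log u * Real.exp (-u) =
    -Real.eulerMascheroniConstant := by
  have h1 := Complex.hasDerivAt_GammaIntegral (s := 1) (by simp)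
  have h2 : HasDerivAt Complex.GammaIntegral (-(Real.eulerMascheroniConstant : ℂ)) 1 := by
    refine Complex.hasDerivAt_Gamma_one.congr_of_eventuallyEq ?_
    have : {s : ℂ | 0 < s.re} ∈ nhds (1 : ℂ) :=
      (isOpen_lt continuous_const Complex.continuous_re).mem_nhds (by simp)
    filter_upwards [this] with s hs
    exact (Complex.Gamma_eq_integral hs).symm
  have h3 := h1.unique h2
  simp only [sub_self, Complex.cpow_zero, one_mul] at h3
  have h4 : ∫ u in Set.Ioi (0 : ℝ), ((Real.log u * Real.exp (-u) : ℝ) : ℂ) =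
      ((-Real.eulerMascheroniConstant : ℝ) : ℂ) := by
    push_cast
    simpa using h3
  rw [integral_complex_ofReal] at h4
  exact_mod_cast h4

lemma abs_log_le (u : ℝ) (hu : 0 < u) :
    |Real.log u| ≤ 2 * u ^ (-(1/2) : ℝ) + 2 * u ^ (1/2 : ℝ) := by
  have h1 := Real.log_le_rpow_div hu.le (ε := 1/2) (by norm_num)
  have h2 := Real.log_le_rpow_div (inv_pos.2 hu).le (ε := 1/2) (by norm_num)
  rw [Real.log_inv, Real.inv_rpow hu.le, ← Real.rpow_neg hu.le] at h2
  have h3 : 0 ≤ u ^ (-(1/2) : ℝ) := by positivity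
  have h4 : 0 ≤ u ^ (1/2 : ℝ) := by positivity
  rw [abs_le]; constructor <;> linarith

open MeasureTheory in
lemma int_rpow (ε s : ℝ) (hε : 0 < ε) (hs : -1 < s) :
    IntegrableOn (fun u : ℝ => u ^ s * Real.exp (-(ε * u))) (Set.Ioi 0) := by
  have := integrableOn_rpow_mul_exp_neg_mul_rpow (p := 1) hs one_pos hε
  simpa using this

open MeasureTheory in
lemma int_log (ε : ℝ) (hε : 0 < ε) :
    IntegrableOn (fun u : ℝ => Real.log u * Real.exp (-(ε * u))) (Set.Ioi 0) := by
  have h := ((int_rpow ε (-(1/2)) hε (by norm_num)).const_mul 2).add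
    ((int_rpow ε (1/2) hε (by norm_num)).const_mul 2)
  refine Integrable.mono' h ?_ ?_
  · exact (by fun_prop : Measurable fun u : ℝ => Real.log u * Real.exp (-(ε * u))).aestronglyMeasurable
  · filter_upwards [ae_restrict_mem measurableSet_Ioi] with u hu
    have := abs_log_le u hu
    rw [norm_mul, Real.norm_eq_abs, Real.norm_eq_abs, Real.abs_exp]
    refine (mul_le_mul_of_nonneg_right this (Real.exp_pos _).le).trans (le_of_eq ?_)
    simp only [Pi.add_apply]
    ring

open MeasureTheory in
lemma integral_log_exp_eps (ε : ℝ) (hε : 0 < ε) :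
    ε * ∫ u in Set.Ioi (0 : ℝ), Real.log u * Real.exp (-(ε * u)) =
    -Real.eulerMascheroniConstant - Real.log ε := by
  have h := integral_comp_mul_left_Ioi (fun u => Real.log u * Real.exp (-u)) 0 hε
  rw [mul_zero, integral_log_exp] at h
  have h2 : ∫ u in Set.Ioi (0 : ℝ), Real.log (ε * u) * Real.exp (-(ε * u)) =
      ∫ u in Set.Ioi (0 : ℝ), (Real.log ε * Real.exp (-(ε * u)) + Real.log u * Real.exp (-(ε * u))) := by
    refine setIntegral_congr_fun measurableSet_Ioi fun u hu => ?_
    rw [Real.log_mul hε.ne' (ne_of_gt hu)]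
    ring
  have h0 := int_rpow ε 0 hε (by norm_num)
  simp only [Real.rpow_zero, one_mul] at h0
  have hI : ∫ u in Set.Ioi (0 : ℝ), Real.exp (-(ε * u)) = ε⁻¹ := by
    have := Real.integral_rpow_mul_exp_neg_mul_Ioi (a := 1) one_pos hε
    simpa using this
  rw [h2, integral_add (h0.const_mul _) (int_log ε hε), integral_const_mul, hI] at h
  simp only [smul_eq_mul] at h
  have : ∫ u in Set.Ioi (0 : ℝ), Real.log u * Real.exp (-(ε * u)) =
    ε⁻¹ * -Real.eulerMascheroniConstant - Real.log ε * ε⁻¹ := by linarith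
  rw [this]
  field_simp

noncomputable def bsum (n : ℕ) : ℝ := ∑ k ∈ Finset.Icc 1 n, if k.Prime then (1 : ℝ) / k else 0

lemma bsum_le (n : ℕ) : bsum n ≤ 1 + Real.log n := by
  refine le_trans ?_ (harmonic_le_one_add_log n)
  rw [harmonic_eq_sum_Icc]
  push_cast
  refine Finset.sum_le_sum fun k _ => ?_
  split_ifs
  · simp
  · positivity

open MeasureTheory in
lemma P_eq (ε : ℝ) (hε : 0 < ε) :
    ∑' p : Nat.Primes, ((p : ℕ) : ℝ) ^ (-(1 + ε)) =
      ε * ∫ u in Set.Ioi (0 : ℝ), bsum ⌊Real.exp u⌋₊ * Real.exp (-(ε * u)) := by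
  set b : ℕ → ℝ := fun k => if k.Prime then (1 : ℝ) / k else 0 with hb
  have h := LSeries_eq_mul_integral_of_nonneg b (r := ε / 2) (s := ε) (by positivity)
    (by simp; linarith) (by
      have h1 : (fun n : ℕ => 1 + Real.log n) =O[Filter.atTop] fun n : ℕ => (n : ℝ) ^ (ε / 2) := by
        refine Asymptotics.IsBigO.add ?_ ?_
        · refine Asymptotics.IsBigO.of_bound 1 ?_
          filter_upwards [Filter.eventually_ge_atTop 1] with n hn
          have : (1 : ℝ) ≤ (n : ℝ) ^ (ε / 2) := Real.one_le_rpow (by exact_mod_cast hn) (by positivity)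
          rw [norm_one, one_mul, Real.norm_of_nonneg (by positivity)]
          exact this
        · exact ((isLittleO_log_rpow_atTop (r := ε / 2) (by positivity)).comp_tendsto
            tendsto_natCast_atTop_atTop).isBigO
      refine Asymptotics.IsBigO.trans ?_ h1
      refine Asymptotics.IsBigO.of_bound 1 (Filter.Eventually.of_forall fun n => ?_)
      rw [one_mul, Real.norm_of_nonneg, Real.norm_of_nonneg]
      · exact bsum_le n
      · have := Real.log_natCast_nonneg n
        positivity
      · exact Finset.sum_nonneg fun k _ => by simp only [hb]; split_ifs <;> positivity)
    (fun n => by simp only [hb]; split_ifs <;> positivity)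
  have hL : LSeries (fun n => (b n : ℂ)) ε =
      ((∑' p : Nat.Primes, ((p : ℕ) : ℝ) ^ (-(1 + ε)) : ℝ) : ℂ) := by
    rw [Complex.ofReal_tsum]
    have := tsum_subtype {p : ℕ | p.Prime} (fun p : ℕ => (((p : ℝ) ^ (-(1 + ε)) : ℝ) : ℂ))
    refine Eq.trans ?_ this.symm
    refine tsum_congr fun n => ?_
    rw [LSeries.term_def]
    by_cases hn : n.Prime
    · have hn0 : n ≠ 0 := hn.ne_zero
      have hnp : (0 : ℝ) < n := by exact_mod_cast hn.pos
      rw [if_neg hn0, Set.indicator_of_mem (by exact hn)]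
      simp only [hb, if_pos hn]
      rw [← Complex.ofReal_natCast, ← Complex.ofReal_cpow hnp.le, ← Complex.ofReal_div]
      congr 1
      rw [neg_add, Real.rpow_add hnp, Real.rpow_neg_one, Real.rpow_neg hnp.le]
      field_simp
    · rw [Set.indicator_of_notMem (by exact hn)]
      simp [hb, hn]
  have hI : ∫ t in Set.Ioi (1 : ℝ), (∑ k ∈ Finset.Icc 1 ⌊t⌋₊, (b k : ℂ)) * (t : ℂ) ^ (-((ε : ℂ) + 1)) =
      ((∫ u in Set.Ioi (0 : ℝ), bsum ⌊Real.exp u⌋₊ * Real.exp (-(ε * u)) : ℝ) : ℂ) := by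
    have him : Real.exp '' Set.Ioi 0 = Set.Ioi 1 := by
      ext t
      simp only [Set.mem_image, Set.mem_Ioi]
      constructor
      · rintro ⟨u, hu, rfl⟩
        exact Real.one_lt_exp_iff.2 hu
      · intro ht
        exact ⟨Real.log t, Real.log_pos ht, Real.exp_log (by linarith)⟩
    rw [← him, integral_image_eq_integral_abs_deriv_smul measurableSet_Ioi
      (fun u _ => (Real.hasDerivAt_exp u).hasDerivWithinAt) (Real.exp_injective.injOn),
      ← integral_complex_ofReal]
    refine setIntegral_congr_fun measurableSet_Ioi fun u hu => ?_
    rw [← Complex.ofReal_sum, ← Complex.ofReal_one, ← Complex.ofReal_add, ← Complex.ofReal_neg,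
      ← Complex.ofReal_cpow (Real.exp_pos u).le, ← Complex.ofReal_mul, Complex.real_smul,
      ← Complex.ofReal_mul, Real.abs_exp, ← Real.exp_mul]
    congr 1
    change _ * (bsum _ * _) = _
    rw [mul_left_comm, ← Real.exp_add]
    ring_nf
  rw [hL, hI] at h
  exact_mod_cast h

lemma bsum_one : bsum 1 = 0 := by
  simp [bsum, Nat.not_prime_one]

lemma bsum_exp_bound (L C : ℝ) (hC : 0 ≤ C) (h : ∀ x : ℝ, 2 ≤ x →
    |bsum ⌊x⌋₊ - Real.log (Real.log x) - L| ≤ C / Real.log x) (u : ℝ) (hu : 0 < u) :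
    |bsum ⌊Real.exp u⌋₊ - Real.log u - L| ≤ (2 * C + 2 + |L|) * u ^ (-(1/2) : ℝ) := by
  have hr : 0 < u ^ (-(1/2) : ℝ) := by positivity
  rcases le_or_gt 2 (Real.exp u) with h2 | h2
  · have h3 := h _ h2
    rw [Real.log_exp] at h3
    refine h3.trans ?_
    have hu2 : Real.log 2 ≤ u := by
      rw [← Real.log_exp u]; exact Real.log_le_log (by norm_num) h2
    have hu3 : 1 / 4 ≤ u := by linarith [Real.log_two_gt_d9]
    have e : 1 / u = u ^ (-(1/2) : ℝ) * u ^ (-(1/2) : ℝ) := by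
      rw [← Real.rpow_add hu]; norm_num [Real.rpow_neg_one]
    have h4 : u ^ (-(1/2) : ℝ) ≤ 2 := by
      by_contra hcon
      push Not at hcon
      have : 1 / u ≤ 4 := by rw [div_le_iff₀ hu]; linarith
      nlinarith
    have : C / u = C * (u ^ (-(1/2) : ℝ) * u ^ (-(1/2) : ℝ)) := by rw [← e]; ring
    rw [this]
    have h5 : u ^ (-(1/2) : ℝ) * u ^ (-(1/2) : ℝ) ≤ 2 * u ^ (-(1/2) : ℝ) :=
      mul_le_mul_of_nonneg_right h4 hr.le
    have h6 := mul_le_mul_of_nonneg_left h5 hC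
    have h7 : 0 ≤ (2 + |L|) * u ^ (-(1/2) : ℝ) := by positivity
    linarith
  · have hf : ⌊Real.exp u⌋₊ = 1 := by
      rw [Nat.floor_eq_iff (Real.exp_pos _).le]
      constructor
      · simpa using hu.le
      · norm_num; exact h2
    rw [hf, bsum_one]
    have hu1 : u ≤ 1 := by
      have := Real.add_one_le_exp u
      linarith
    have h1 : 1 ≤ u ^ (-(1/2) : ℝ) := Real.one_le_rpow_of_pos_of_le_one_of_nonpos hu hu1 (by norm_num)
    have h3 := Real.log_le_rpow_div (inv_pos.2 hu).le (ε := 1/2) (by norm_num)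
    rw [Real.log_inv, Real.inv_rpow hu.le, ← Real.rpow_neg hu.le] at h3
    have h4 := Real.log_nonpos hu.le hu1
    have h5 : |L| ≤ |L| * u ^ (-(1/2) : ℝ) := le_mul_of_one_le_right (abs_nonneg _) h1
    have h6 : 0 ≤ 2 * C * u ^ (-(1/2) : ℝ) := by positivity
    have := abs_le.1 (le_refl |L|)
    rw [abs_le]
    constructor <;> nlinarith [this.1, this.2]

open MeasureTheory in
lemma P_bound (L C : ℝ) (hC : 0 ≤ C) (h : ∀ x : ℝ, 2 ≤ x →
    |bsum ⌊x⌋₊ - Real.log (Real.log x) - L| ≤ C / Real.log x) (ε : ℝ) (hε : 0 < ε) :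
    |∑' p : Nat.Primes, ((p : ℕ) : ℝ) ^ (-(1 + ε)) + Real.log ε
      + Real.eulerMascheroniConstant - L| ≤
      (2 * C + 2 + |L|) * Real.Gamma (1/2) * ε ^ (1/2 : ℝ) := by
  set D := 2 * C + 2 + |L| with hD
  have hD0 : 0 ≤ D := by positivity
  have h0 := int_rpow ε 0 hε (by norm_num)
  simp only [Real.rpow_zero, one_mul] at h0
  have h1 := (int_rpow ε (-(1/2)) hε (by norm_num)).const_mul D
  have hI : ∫ u in Set.Ioi (0 : ℝ), Real.exp (-(ε * u)) = ε⁻¹ := by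
    have := Real.integral_rpow_mul_exp_neg_mul_Ioi (a := 1) one_pos hε
    simpa using this
  have hbd : ∀ᵐ u ∂(volume.restrict (Set.Ioi (0 : ℝ))),
      ‖(bsum ⌊Real.exp u⌋₊ - Real.log u - L) * Real.exp (-(ε * u))‖ ≤
        D * (u ^ (-(1/2) : ℝ) * Real.exp (-(ε * u))) := by
    filter_upwards [ae_restrict_mem measurableSet_Ioi] with u hu
    rw [norm_mul, Real.norm_eq_abs, Real.norm_eq_abs, Real.abs_exp, ← mul_assoc]
    exact mul_le_mul_of_nonneg_right (bsum_exp_bound L C hC h u hu) (Real.exp_pos _).le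
  have hm : Measurable fun u : ℝ => bsum ⌊Real.exp u⌋₊ :=
    (measurable_from_top (f := bsum)).comp (Nat.measurable_floor.comp Real.measurable_exp)
  have hint : IntegrableOn (fun u => (bsum ⌊Real.exp u⌋₊ - Real.log u - L) * Real.exp (-(ε * u)))
      (Set.Ioi 0) := by
    refine Integrable.mono' h1 ?_ hbd
    exact (by fun_prop : Measurable fun u => (bsum ⌊Real.exp u⌋₊ - Real.log u - L) *
      Real.exp (-(ε * u))).aestronglyMeasurable
  have hle := norm_integral_le_of_norm_le h1 hbd
  have hB : ∫ u in Set.Ioi (0 : ℝ), bsum ⌊Real.exp u⌋₊ * Real.exp (-(ε * u)) =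
      (∫ u in Set.Ioi (0 : ℝ), (bsum ⌊Real.exp u⌋₊ - Real.log u - L) * Real.exp (-(ε * u))) +
      (∫ u in Set.Ioi (0 : ℝ), Real.log u * Real.exp (-(ε * u))) + L * ε⁻¹ := by
    rw [← hI, ← integral_const_mul, ← integral_add hint (int_log ε hε)]
    refine Eq.trans ?_ (integral_add (hint.add (int_log ε hε)) (h0.const_mul L))
    refine integral_congr_ae (Filter.Eventually.of_forall fun u => ?_)
    simp only [Pi.add_apply]
    ring
  have hG := Real.integral_rpow_mul_exp_neg_mul_Ioi (a := 1/2) (by norm_num) hε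
  rw [integral_const_mul, show (-(1/2) : ℝ) = 1/2 - 1 by norm_num, hG, Real.norm_eq_abs] at hle
  rw [P_eq ε hε, hB, mul_add, mul_add, integral_log_exp_eps ε hε]
  set J := ∫ u in Set.Ioi (0 : ℝ), (bsum ⌊Real.exp u⌋₊ - Real.log u - L) * Real.exp (-(ε * u))
  have e : ε * J + (-Real.eulerMascheroniConstant - Real.log ε) + ε * (L * ε⁻¹) + Real.log ε +
      Real.eulerMascheroniConstant - L = ε * J := by
    field_simp; ring
  rw [e, abs_mul, abs_of_pos hε]
  refine (mul_le_mul_of_nonneg_left hle hε.le).trans (le_of_eq ?_)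
  rw [one_div, Real.inv_rpow hε.le, ← Real.rpow_neg hε.le]
  have : ε * ε ^ (-(1/2) : ℝ) = ε ^ (1/2 : ℝ) := by
    nth_rewrite 1 [← Real.rpow_one ε]
    rw [← Real.rpow_add hε]; norm_num
  rw [← this]
  ring

lemma log_one_sub_bound (q : ℝ) (h0 : 0 ≤ q) (h1 : q ≤ 1 / 2) :
    |Real.log (1 - q) + q| ≤ 2 * q ^ 2 := by
  have h := Real.abs_log_sub_add_sum_range_le (x := q) (by rw [abs_of_nonneg h0]; linarith) 1
  simp only [Finset.range_one, Finset.sum_singleton, zero_add, pow_one, Nat.cast_zero, div_one,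
    abs_of_nonneg h0] at h
  rw [add_comm]
  refine h.trans ?_
  rw [div_le_iff₀ (by linarith)]
  norm_num
  nlinarith [sq_nonneg q]

lemma prime_two_le (p : Nat.Primes) : (2 : ℝ) ≤ ((p : ℕ) : ℝ) := by exact_mod_cast p.2.two_le

lemma summable_inv_sq_primes : Summable (fun p : Nat.Primes => 2 * (((p : ℕ) : ℝ) ^ (-2 : ℝ))) :=
  (Nat.Primes.summable_rpow.2 (by norm_num)).mul_left 2

lemma q_bounds (p : Nat.Primes) (ε : ℝ) (hε : 0 ≤ ε) :
    0 ≤ ((p : ℕ) : ℝ) ^ (-(1 + ε)) ∧ ((p : ℕ) : ℝ) ^ (-(1 + ε)) ≤ 1 / 2 ∧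
    (((p : ℕ) : ℝ) ^ (-(1 + ε))) ^ 2 ≤ ((p : ℕ) : ℝ) ^ (-2 : ℝ) := by
  have hp := prime_two_le p
  have h1 : ((p : ℕ) : ℝ) ^ (-(1 + ε)) ≤ ((p : ℕ) : ℝ) ^ (-1 : ℝ) :=
    Real.rpow_le_rpow_of_exponent_le (by linarith) (by linarith)
  have h0 : 0 ≤ ((p : ℕ) : ℝ) ^ (-(1 + ε)) := by positivity
  refine ⟨h0, h1.trans ?_, ?_⟩
  · rw [Real.rpow_neg_one, one_div]
    exact inv_anti₀ (by norm_num) hp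
  · refine (pow_le_pow_left₀ h0 h1 2).trans (le_of_eq ?_)
    rw [← Real.rpow_natCast, ← Real.rpow_mul (by positivity)]
    norm_num

lemma q_term_bound (p : Nat.Primes) (ε : ℝ) (hε : 0 ≤ ε) :
    ‖Real.log (1 - ((p : ℕ) : ℝ) ^ (-(1 + ε))) + ((p : ℕ) : ℝ) ^ (-(1 + ε))‖ ≤
      2 * (((p : ℕ) : ℝ) ^ (-2 : ℝ)) := by
  obtain ⟨h0, h1, h2⟩ := q_bounds p ε hε
  refine (log_one_sub_bound _ h0 h1).trans ?_
  linarith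

lemma Q_tendsto : Filter.Tendsto (fun ε : ℝ =>
    (∑' p : Nat.Primes, -Real.log (1 - ((p : ℕ) : ℝ) ^ (-(1 + ε)))) + Real.log ε)
    (nhdsWithin 0 (Set.Ioi 0)) (nhds 0) := by
  have h1 : Filter.Tendsto (fun ε : ℝ => ((1 + ε : ℝ) : ℂ)) (nhdsWithin 0 (Set.Ioi 0))
      (nhdsWithin 1 {1}ᶜ) := by
    rw [tendsto_nhdsWithin_iff]
    constructor
    · have : Filter.Tendsto (fun ε : ℝ => ((1 + ε : ℝ) : ℂ)) (nhds 0) (nhds ((1 + 0 : ℝ) : ℂ)) :=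
        (by fun_prop : Continuous (fun ε : ℝ => ((1 + ε : ℝ) : ℂ))).tendsto 0
      simp only [add_zero, Complex.ofReal_one] at this
      exact this.mono_left nhdsWithin_le_nhds
    · filter_upwards [self_mem_nhdsWithin] with ε hε
      simp only [Set.mem_compl_iff, Set.mem_singleton_iff]
      intro h
      have h' : (1 + ε : ℝ) = 1 := by exact_mod_cast h
      have : (0 : ℝ) < ε := hε
      linarith
  have h2 := riemannZeta_residue_one.comp h1
  have h3 := (Complex.continuous_re.tendsto 1).comp h2
  simp only [Complex.one_re] at h3
  have h4 : Filter.Tendsto (fun ε : ℝ => ε *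
      Real.exp (∑' p : Nat.Primes, -Real.log (1 - ((p : ℕ) : ℝ) ^ (-(1 + ε)))))
      (nhdsWithin 0 (Set.Ioi 0)) (nhds 1) := by
    refine h3.congr' ?_
    filter_upwards [self_mem_nhdsWithin] with ε hε
    have hε0 : (0 : ℝ) < ε := hε
    simp only [Function.comp]
    rw [← riemannZeta_eulerProduct_exp_log (by simpa using hε0)]
    have : ∑' p : Nat.Primes, -Complex.log (1 - ((p : ℕ) : ℂ) ^ (-((1 + ε : ℝ) : ℂ))) =
        ((∑' p : Nat.Primes, -Real.log (1 - ((p : ℕ) : ℝ) ^ (-(1 + ε))) : ℝ) : ℂ) := by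
      rw [Complex.ofReal_tsum]
      refine tsum_congr fun p => ?_
      obtain ⟨h0, h1, h2⟩ := q_bounds p ε hε0.le
      rw [← Complex.ofReal_natCast, ← Complex.ofReal_neg, ← Complex.ofReal_cpow (by positivity),
        ← Complex.ofReal_one, ← Complex.ofReal_sub, ← Complex.ofReal_log (by linarith),
        ← Complex.ofReal_neg]
    rw [this, ← Complex.ofReal_exp, ← Complex.ofReal_one, ← Complex.ofReal_sub,
      ← Complex.ofReal_mul, Complex.ofReal_re]
    ring
  have h5 := (Real.continuousAt_log one_ne_zero).tendsto.comp h4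
  rw [Real.log_one] at h5
  refine h5.congr' ?_
  filter_upwards [self_mem_nhdsWithin] with ε hε
  have hε0 : (0 : ℝ) < ε := hε
  simp only [Function.comp]
  rw [Real.log_mul hε0.ne' (Real.exp_pos _).ne', Real.log_exp, add_comm]

lemma summable_S : Summable (fun p : Nat.Primes =>
    Real.log (1 - 1 / ((p : ℕ) : ℝ)) + 1 / ((p : ℕ) : ℝ)) := by
  refine Summable.of_norm_bounded summable_inv_sq_primes fun p => ?_
  have := q_term_bound p 0 le_rfl
  simpa [Real.rpow_neg_one] using this

lemma mertens_const (L C : ℝ) (hC : 0 ≤ C) (h : ∀ x : ℝ, 2 ≤ x →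
    |bsum ⌊x⌋₊ - Real.log (Real.log x) - L| ≤ C / Real.log x) :
    L = Real.eulerMascheroniConstant +
      ∑' p : Nat.Primes, (Real.log (1 - 1 / ((p : ℕ) : ℝ)) + 1 / ((p : ℕ) : ℝ)) := by
  have t1 : Filter.Tendsto (fun ε : ℝ => ∑' p : Nat.Primes,
      (Real.log (1 - ((p : ℕ) : ℝ) ^ (-(1 + ε))) + ((p : ℕ) : ℝ) ^ (-(1 + ε))))
      (nhdsWithin 0 (Set.Ioi 0))
      (nhds (∑' p : Nat.Primes, (Real.log (1 - 1 / ((p : ℕ) : ℝ)) + 1 / ((p : ℕ) : ℝ)))) := by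
    refine tendsto_tsum_of_dominated_convergence summable_inv_sq_primes (fun p => ?_) ?_
    · have hp := prime_two_le p
      have c : Filter.Tendsto (fun ε : ℝ => ((p : ℕ) : ℝ) ^ (-(1 + ε))) (nhdsWithin 0 (Set.Ioi 0))
          (nhds (1 / ((p : ℕ) : ℝ))) := by
        have : Continuous (fun ε : ℝ => ((p : ℕ) : ℝ) ^ (-(1 + ε))) :=
          Real.continuous_const_rpow (by positivity) |>.comp (by fun_prop)
        have := (this.tendsto 0).mono_left (nhdsWithin_le_nhds (s := Set.Ioi 0))
        simpa [Real.rpow_neg_one] using this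
      have hq : 1 / ((p : ℕ) : ℝ) ≤ 1 / 2 := one_div_le_one_div_of_le (by norm_num) hp
      refine Filter.Tendsto.add ?_ c
      exact (Real.continuousAt_log (by linarith)).tendsto.comp (c.const_sub 1)
    · filter_upwards [self_mem_nhdsWithin] with ε hε p
      exact q_term_bound p ε (le_of_lt hε)
  have t2 := t1.add Q_tendsto
  have t3 : Filter.Tendsto (fun ε : ℝ =>
      ∑' p : Nat.Primes, ((p : ℕ) : ℝ) ^ (-(1 + ε)) + Real.log ε)
      (nhdsWithin 0 (Set.Ioi 0))
      (nhds (∑' p : Nat.Primes, (Real.log (1 - 1 / ((p : ℕ) : ℝ)) + 1 / ((p : ℕ) : ℝ)))) := by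
    rw [add_zero] at t2
    refine t2.congr' ?_
    filter_upwards [self_mem_nhdsWithin] with ε hε
    have hε0 : (0 : ℝ) < ε := hε
    have s1 : Summable (fun p : Nat.Primes =>
        (Real.log (1 - ((p : ℕ) : ℝ) ^ (-(1 + ε))) + ((p : ℕ) : ℝ) ^ (-(1 + ε)))) :=
      Summable.of_norm_bounded summable_inv_sq_primes fun p => q_term_bound p ε hε0.le
    have s2 : Summable (fun p : Nat.Primes => ((p : ℕ) : ℝ) ^ (-(1 + ε))) :=
      Nat.Primes.summable_rpow.2 (by linarith)
    have s3 : Summable (fun p : Nat.Primes => -Real.log (1 - ((p : ℕ) : ℝ) ^ (-(1 + ε)))) :=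
      (s2.sub s1).congr fun p => by ring
    rw [← add_assoc, ← s1.tsum_add s3]
    congr 1
    exact tsum_congr fun p => by ring
  have t4 : Filter.Tendsto (fun ε : ℝ =>
      ∑' p : Nat.Primes, ((p : ℕ) : ℝ) ^ (-(1 + ε)) + Real.log ε
        + Real.eulerMascheroniConstant - L) (nhdsWithin 0 (Set.Ioi 0)) (nhds 0) := by
    have c : Filter.Tendsto (fun ε : ℝ => (2 * C + 2 + |L|) * Real.Gamma (1/2) * ε ^ (1/2 : ℝ))
        (nhdsWithin 0 (Set.Ioi 0)) (nhds 0) := by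
      have := (Real.continuous_rpow_const (q := 1/2) (by norm_num)).tendsto 0
      have := (this.const_mul ((2 * C + 2 + |L|) * Real.Gamma (1/2))).mono_left
        (nhdsWithin_le_nhds (s := Set.Ioi 0))
      rw [Real.zero_rpow (by norm_num), mul_zero] at this
      exact this
    refine squeeze_zero_norm' ?_ c
    filter_upwards [self_mem_nhdsWithin] with ε hε
    exact P_bound L C hC h ε hε
  have := tendsto_nhds_unique t4 ((t3.add_const _).sub_const L)
  linarith

lemma mertens : ∃ C : ℝ, 0 ≤ C ∧ ∀ x : ℝ, 2 ≤ x →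
    |bsum ⌊x⌋₊ - Real.log (Real.log x) - (Real.eulerMascheroniConstant +
      ∑' p : Nat.Primes, (Real.log (1 - 1 / ((p : ℕ) : ℝ)) + 1 / ((p : ℕ) : ℝ)))|
      ≤ C / Real.log x := by
  obtain ⟨L, C, hC, h⟩ := mertens2_real
  refine ⟨C, hC, fun x hx => ?_⟩
  rw [← mertens_const L C hC h]
  exact h x hx

lemma f_one (f : ℕ → ℂ) (hadd : ∀ m n : ℕ, Nat.Coprime m n → f (m * n) = f m + f n) : f 1 = 0 := by
  have := hadd 1 1 (by simp)
  simpa using this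

lemma f_eq_sum (f : ℕ → ℂ) (hadd : ∀ m n : ℕ, Nat.Coprime m n → f (m * n) = f m + f n)
    (n : ℕ) (hn : n ≠ 0) : f n = ∑ p ∈ n.primeFactors, f (p ^ n.factorization p) := by
  have h := Nat.multiplicative_factorization (β := Multiplicative ℂ)
    (fun n => Multiplicative.ofAdd (f n)) (fun x y hxy => by rw [hadd x y hxy]; rfl)
    (by rw [f_one f hadd]; rfl) hn
  have h2 := congrArg Multiplicative.toAdd h
  rw [Finsupp.prod, toAdd_prod] at h2
  simpa using h2

lemma f_eq_double (f : ℕ → ℂ) (hadd : ∀ m n : ℕ, Nat.Coprime m n → f (m * n) = f m + f n)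
    (N n : ℕ) (hn : 1 ≤ n) (hnN : n ≤ N) :
    f n = ∑ p ∈ (Finset.Icc 1 N).filter Nat.Prime, ∑ k ∈ Finset.range N,
      if p ^ (k + 1) ∣ n then f (p ^ (k + 1)) - f (p ^ k) else 0 := by
  have key : ∀ p : ℕ, p.Prime → f (p ^ n.factorization p) = ∑ k ∈ Finset.range N,
      if p ^ (k + 1) ∣ n then f (p ^ (k + 1)) - f (p ^ k) else 0 := by
    intro p hp
    have hv : n.factorization p ≤ N := (Nat.factorization_lt p (by omega)).le.trans hnN
    have e : ∀ k, p ^ (k + 1) ∣ n ↔ k < n.factorization p := fun k => by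
      rw [hp.pow_dvd_iff_le_factorization (by omega)]; omega
    simp_rw [e]
    rw [← Finset.sum_filter]
    have : (Finset.range N).filter (fun k => k < n.factorization p) =
        Finset.range (n.factorization p) := by
      ext k; simp only [Finset.mem_filter, Finset.mem_range]; omega
    rw [this, Finset.sum_range_sub (fun k => f (p ^ k)), pow_zero, f_one f hadd, sub_zero]
  rw [f_eq_sum f hadd n (by omega)]
  rw [Finset.sum_subset (s₂ := (Finset.Icc 1 N).filter Nat.Prime)]
  · exact Finset.sum_congr rfl fun p hp => key p (Finset.mem_filter.1 hp).2
  · intro p hp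
    have hpp := Nat.prime_of_mem_primeFactors hp
    have := Nat.le_of_mem_primeFactors hp
    simp only [Finset.mem_filter, Finset.mem_Icc]
    exact ⟨⟨hpp.pos, by omega⟩, hpp⟩
  · intro p _ hp
    rw [← Nat.support_factorization, Finsupp.notMem_support_iff] at hp
    rw [hp, pow_zero, f_one f hadd]

lemma S_eq (f : ℕ → ℂ) (hadd : ∀ m n : ℕ, Nat.Coprime m n → f (m * n) = f m + f n) (N : ℕ) :
    ∑ n₁ ∈ Finset.Icc 1 N, ∑ n₂ ∈ Finset.Icc 1 N, f (Nat.gcd n₁ n₂) =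
    ∑ p ∈ (Finset.Icc 1 N).filter Nat.Prime, ∑ k ∈ Finset.range N,
      (f (p ^ (k + 1)) - f (p ^ k)) * ((N / p ^ (k + 1) : ℕ) : ℂ) ^ 2 := by
  have h1 : ∀ a ∈ Finset.Icc 1 N, ∀ b ∈ Finset.Icc 1 N, f (Nat.gcd a b) =
      ∑ p ∈ (Finset.Icc 1 N).filter Nat.Prime, ∑ k ∈ Finset.range N,
        (if p ^ (k + 1) ∣ a then (1 : ℂ) else 0) * (if p ^ (k + 1) ∣ b then (1 : ℂ) else 0) *
        (f (p ^ (k + 1)) - f (p ^ k)) := by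
    intro a ha b hb
    rw [Finset.mem_Icc] at ha hb
    rw [f_eq_double f hadd N (Nat.gcd a b) (Nat.gcd_pos_of_pos_left _ ha.1)
      ((Nat.gcd_le_left _ ha.1).trans ha.2)]
    refine Finset.sum_congr rfl fun p _ => Finset.sum_congr rfl fun k _ => ?_
    simp only [Nat.dvd_gcd_iff]
    by_cases h1 : p ^ (k + 1) ∣ a <;> by_cases h2 : p ^ (k + 1) ∣ b <;> simp [h1, h2]
  rw [Finset.sum_congr rfl fun a ha => Finset.sum_congr rfl fun b hb => h1 a ha b hb]
  have hc : ∀ d : ℕ, ∑ a ∈ Finset.Icc 1 N, (if d ∣ a then (1 : ℂ) else 0) = ((N / d : ℕ) : ℂ) := by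
    intro d
    rw [Finset.sum_boole]
    congr 1
    exact Nat.Ioc_filter_dvd_card_eq_div N d
  simp_rw [Finset.sum_comm (s := Finset.Icc 1 N) (t := (Finset.Icc 1 N).filter Nat.Prime)]
  refine Finset.sum_congr rfl fun p _ => ?_
  simp_rw [Finset.sum_comm (s := Finset.Icc 1 N) (t := Finset.range N)]
  refine Finset.sum_congr rfl fun k _ => ?_
  simp_rw [← Finset.sum_mul, ← Finset.mul_sum, ← Finset.sum_mul, hc]
  ring

lemma floor_sq_bound (y : ℝ) (hy : 0 < y) :
    |y ^ 2 - (⌊y⌋₊ : ℝ) ^ 2| ≤ 2 * y ∧ |y ^ 2 - (⌊y⌋₊ : ℝ) ^ 2| ≤ 2 * y ^ (7/4 : ℝ) := by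
  have h1 := Nat.floor_le hy.le
  have h2 := Nat.lt_floor_add_one y
  have h0 : (0 : ℝ) ≤ ⌊y⌋₊ := by positivity
  have hA : |y ^ 2 - (⌊y⌋₊ : ℝ) ^ 2| ≤ 2 * y := by
    rw [abs_of_nonneg (by nlinarith)]
    nlinarith
  refine ⟨hA, ?_⟩
  rcases le_or_gt 1 y with h | h
  · refine hA.trans ?_
    have : y ^ (1 : ℝ) ≤ y ^ (7/4 : ℝ) := Real.rpow_le_rpow_of_exponent_le h (by norm_num)
    rw [Real.rpow_one] at this
    linarith
  · have : ⌊y⌋₊ = 0 := Nat.floor_eq_zero.2 h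
    rw [this]
    have h3 : y ^ (2 : ℝ) ≤ y ^ (7/4 : ℝ) := Real.rpow_le_rpow_of_exponent_ge hy h.le (by norm_num)
    rw [Real.rpow_two] at h3
    have : 0 ≤ y ^ 2 := by positivity
    simp only [Nat.cast_zero, ne_eq, OfNat.ofNat_ne_zero, not_false_eq_true, zero_pow, sub_zero]
    rw [abs_of_nonneg this]
    linarith

lemma floor_div_nat (x : ℝ) (q : ℕ) : ⌊x⌋₊ / q = ⌊x / q⌋₊ := (Nat.floor_div_natCast x q).symm

/-- bound at q -/
lemma q_floor_bound (x : ℝ) (hx : 0 < x) (q : ℕ) (hq : 0 < q) :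
    (q : ℝ) * |x ^ 2 / (q : ℝ) ^ 2 - ((⌊x⌋₊ / q : ℕ) : ℝ) ^ 2| ≤ 2 * x ∧
    (q : ℝ) * |x ^ 2 / (q : ℝ) ^ 2 - ((⌊x⌋₊ / q : ℕ) : ℝ) ^ 2| ≤
      2 * x ^ (7/4 : ℝ) * (q : ℝ) ^ (-(3/4) : ℝ) := by
  have hq0 : (0 : ℝ) < q := by exact_mod_cast hq
  rw [floor_div_nat, ← div_pow]
  obtain ⟨h1, h2⟩ := floor_sq_bound (x / q) (by positivity)
  constructor
  · refine (mul_le_mul_of_nonneg_left h1 hq0.le).trans (le_of_eq ?_)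
    field_simp
  · refine (mul_le_mul_of_nonneg_left h2 hq0.le).trans (le_of_eq ?_)
    rw [Real.div_rpow hx.le hq0.le]
    have : (q : ℝ) ^ (-(3/4) : ℝ) = q / (q : ℝ) ^ (7/4 : ℝ) := by
      nth_rewrite 2 [← Real.rpow_one (q : ℝ)]
      rw [← Real.rpow_sub hq0]; norm_num
    rw [this]; ring

noncomputable def Wt (l : ℕ) (z : Nat.Primes × ℕ) : ℝ :=
  ((z.1 : ℕ) : ℝ) ^ (-(3/2) : ℝ) * (((z.2 : ℝ) + 2) ^ l * ((2 : ℝ) ^ (-(3/4) : ℝ)) ^ z.2)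

lemma poly_geom_summable (l : ℕ) (r : ℝ) (h0 : 0 < r) (h1 : r < 1) (j : ℕ) :
    Summable (fun k : ℕ => ((k : ℝ) + j) ^ l * r ^ k) := by
  have h := summable_pow_mul_geometric_of_norm_lt_one (R := ℝ) l (r := r)
    (by rwa [Real.norm_of_nonneg h0.le])
  have h2 := ((summable_nat_add_iff j).2 h).mul_left (r ^ j)⁻¹
  refine h2.congr fun k => ?_
  push_cast
  rw [pow_add]
  field_simp

lemma Wt_summable (l : ℕ) : Summable (Wt l) := by
  refine Summable.mul_of_nonneg (f := fun p : Nat.Primes => ((p : ℕ) : ℝ) ^ (-(3/2) : ℝ))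
    (g := fun k : ℕ => ((k : ℝ) + 2) ^ l * ((2 : ℝ) ^ (-(3/4) : ℝ)) ^ k) ?_ ?_ ?_ ?_
  · exact Nat.Primes.summable_rpow.2 (by norm_num)
  · exact_mod_cast poly_geom_summable l ((2 : ℝ) ^ (-(3/4) : ℝ)) (by positivity)
      (Real.rpow_lt_one_of_one_lt_of_neg (by norm_num) (by norm_num)) 2
  · intro p; simp only [Pi.zero_apply]; positivity
  · intro k; simp only [Pi.zero_apply]; positivity

lemma Wt_nonneg (l : ℕ) (z) : 0 ≤ Wt l z := by unfold Wt; positivity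

lemma Wt_bound (l : ℕ) (p : Nat.Primes) (k : ℕ) :
    ((k : ℝ) + 2) ^ l * ((((p : ℕ) ^ (k + 2) : ℕ)) : ℝ) ^ (-(3/4) : ℝ) ≤ Wt l (p, k) := by
  have hp := prime_two_le p
  have hp0 : (0 : ℝ) < ((p : ℕ) : ℝ) := by linarith
  have e : ((((p : ℕ) ^ (k + 2) : ℕ)) : ℝ) ^ (-(3/4) : ℝ) =
      ((p : ℕ) : ℝ) ^ (-(3/2) : ℝ) * (((p : ℕ) : ℝ) ^ (-(3/4) : ℝ)) ^ k := by
    push_cast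
    rw [← Real.rpow_natCast, ← Real.rpow_natCast, ← Real.rpow_mul hp0.le, ← Real.rpow_mul hp0.le,
      ← Real.rpow_add hp0]
    congr 1
    push_cast
    ring
  rw [e]
  unfold Wt
  simp only
  have h1 : ((p : ℕ) : ℝ) ^ (-(3/4) : ℝ) ≤ (2 : ℝ) ^ (-(3/4) : ℝ) :=
    Real.rpow_le_rpow_of_nonpos (by norm_num) hp (by norm_num)
  rw [mul_left_comm]
  gcongr

lemma g_bound (f : ℕ → ℂ) (hp1 : ∀ p : ℕ, p.Prime → f p = (p : ℂ)) (l : ℕ) (K : ℝ)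
    (hK : ∀ p : ℕ, p.Prime → ∀ ν : ℕ, 2 ≤ ν → ‖f (p ^ ν)‖ ≤ K * (ν : ℝ) ^ l * (p : ℝ) ^ ν)
    (p : ℕ) (hp : p.Prime) (k : ℕ) :
    ‖f (p ^ (k + 1))‖ ≤ (|K| + 1) * ((k : ℝ) + 1) ^ l * (p : ℝ) ^ (k + 1) ∧
    ‖f (p ^ (k + 2)) - f (p ^ (k + 1))‖ ≤
      2 * (|K| + 1) * ((k : ℝ) + 2) ^ l * ((p ^ (k + 2) : ℕ) : ℝ) := by
  have A : ∀ k : ℕ, ‖f (p ^ (k + 1))‖ ≤ (|K| + 1) * ((k : ℝ) + 1) ^ l * (p : ℝ) ^ (k + 1) := by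
    intro k
    rcases Nat.eq_zero_or_pos k with rfl | hk
    · simp only [zero_add, pow_one, hp1 p hp, Nat.cast_zero, one_pow, mul_one, Complex.norm_natCast]
      have : (0 : ℝ) ≤ p := by positivity
      nlinarith [abs_nonneg K]
    · refine (hK p hp (k + 1) (by omega)).trans ?_
      push_cast
      gcongr
      linarith [le_abs_self K]
  refine ⟨A k, ?_⟩
  have h1 := A (k + 1)
  have h2 := A k
  have hp1' : (1 : ℝ) ≤ p := by exact_mod_cast hp.one_le
  have h3 : (|K| + 1) * ((k : ℝ) + 1) ^ l * (p : ℝ) ^ (k + 1) ≤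
      (|K| + 1) * ((k : ℝ) + 2) ^ l * (p : ℝ) ^ (k + 2) := by
    gcongr
    · norm_num
    · norm_num
  have h4 : (((k + 1 : ℕ) : ℝ) + 1) = (k : ℝ) + 2 := by push_cast; ring
  rw [h4] at h1
  refine (norm_sub_le _ _).trans ((add_le_add h1 (h2.trans h3)).trans (le_of_eq ?_))
  push_cast
  ring

lemma term_eq (f : ℕ → ℂ) (hadd : ∀ m n : ℕ, Nat.Coprime m n → f (m * n) = f m + f n)
    (hp1 : ∀ p : ℕ, p.Prime → f p = (p : ℂ)) (l : ℕ) (K : ℝ)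
    (hK : ∀ p : ℕ, p.Prime → ∀ ν : ℕ, 2 ≤ ν → ‖f (p ^ ν)‖ ≤ K * (ν : ℝ) ^ l * (p : ℝ) ^ ν)
    (p : ℕ) (hp : p.Prime) :
    (1 - 1 / (p : ℂ) ^ 2) * ∑' ν : ℕ, f (p ^ (ν + 1)) / (p : ℂ) ^ (2 * (ν + 1)) =
      1 / (p : ℂ) + ∑' k : ℕ, (f (p ^ (k + 2)) - f (p ^ (k + 1))) / ((p ^ (k + 2) : ℕ) : ℂ) ^ 2 := by
  have hp0 : (p : ℂ) ≠ 0 := by exact_mod_cast hp.ne_zero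
  have hp2 : (2 : ℝ) ≤ p := by exact_mod_cast hp.two_le
  set a : ℕ → ℂ := fun ν => f (p ^ ν) / (p : ℂ) ^ (2 * ν) with ha
  have ha0 : a 0 = 0 := by simp [ha, f_one f hadd]
  have hs : Summable (fun ν => a (ν + 1)) := by
    have hgs := (poly_geom_summable l ((p : ℝ)⁻¹) (by positivity)
      (inv_lt_one_of_one_lt₀ (by linarith)) 1).mul_left ((|K| + 1) * (p : ℝ)⁻¹)
    refine Summable.of_norm_bounded hgs fun ν => ?_
    have := (g_bound f hp1 l K hK p hp ν).1
    simp only [ha, norm_div, norm_pow, Complex.norm_natCast]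
    rw [div_le_iff₀ (by positivity)]
    refine this.trans (le_of_eq ?_)
    push_cast
    rw [inv_pow]
    have : (p : ℝ) ≠ 0 := by linarith
    field_simp
    ring
  have hs0 : Summable a := (summable_nat_add_iff 1).1 hs
  have hA : ∑' ν, a ν = ∑' ν, a (ν + 1) := by
    rw [hs0.tsum_eq_zero_add, ha0, zero_add]
  set g : ℕ → ℂ := fun k => a (k + 1) - a k / (p : ℂ) ^ 2 with hg
  have hgs : Summable g := hs.sub (hs0.div_const _)
  have e1 : ∑' k, g k = (1 - 1 / (p : ℂ) ^ 2) * ∑' ν, a (ν + 1) := by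
    rw [hs.tsum_sub (hs0.div_const _), tsum_div_const, hA]
    ring
  have e2 := hgs.tsum_eq_zero_add
  change (1 - 1 / (p : ℂ) ^ 2) * ∑' ν, a (ν + 1) = _
  rw [← e1, e2]
  congr 1
  · simp only [hg, ha0, zero_add, zero_div, sub_zero]
    simp only [ha, pow_one, mul_one, hp1 p hp]
    field_simp
  · refine tsum_congr fun k => ?_
    simp only [hg, ha]
    push_cast
    change _ = (f (p ^ (k + 1 + 1)) - f (p ^ (k + 1))) / ((p : ℂ) ^ (k + 2)) ^ 2
    generalize f (p ^ (k + 1 + 1)) = A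
    generalize f (p ^ (k + 1)) = B
    field_simp
    ring

lemma finset_to_tsum (G : ℕ → ℂ) (N : ℕ) (h : ∀ p : ℕ, p.Prime → N < p → G p = 0) :
    ∑ p ∈ (Finset.Icc 1 N).filter Nat.Prime, G p = ∑' p : Nat.Primes, G p := by
  have := tsum_subtype {p : ℕ | p.Prime} G
  refine Eq.trans ?_ this.symm
  rw [tsum_eq_sum (s := (Finset.Icc 1 N).filter Nat.Prime)]
  · refine Finset.sum_congr rfl fun p hp => ?_
    rw [Set.indicator_of_mem (by exact (Finset.mem_filter.1 hp).2)]
  · intro p hp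
    by_cases hpp : p.Prime
    · rw [Set.indicator_of_mem (by exact hpp)]
      refine h p hpp ?_
      by_contra hcon
      exact hp (Finset.mem_filter.2 ⟨Finset.mem_Icc.2 ⟨hpp.pos, by omega⟩, hpp⟩)
    · rw [Set.indicator_of_notMem (by exact hpp)]

/-- sum over higher prime powers -/
lemma higher (f : ℕ → ℂ)
    (hp1 : ∀ p : ℕ, p.Prime → f p = (p : ℂ)) (l : ℕ) (K : ℝ)
    (hK : ∀ p : ℕ, p.Prime → ∀ ν : ℕ, 2 ≤ ν → ‖f (p ^ ν)‖ ≤ K * (ν : ℝ) ^ l * (p : ℝ) ^ ν) :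
    Summable (fun z : Nat.Primes × ℕ =>
      (f ((z.1 : ℕ) ^ (z.2 + 2)) - f ((z.1 : ℕ) ^ (z.2 + 1))) / (((z.1 : ℕ) ^ (z.2 + 2) : ℕ) : ℂ) ^ 2) ∧
    ∀ x : ℝ, 1 ≤ x →
    ‖∑ p ∈ (Finset.Icc 1 ⌊x⌋₊).filter Nat.Prime, ∑ k ∈ Finset.range (⌊x⌋₊ - 1),
      (f (p ^ (k + 2)) - f (p ^ (k + 1))) * ((⌊x⌋₊ / p ^ (k + 2) : ℕ) : ℂ) ^ 2 -
      (x : ℂ) ^ 2 * ∑' z : Nat.Primes × ℕ,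
      (f ((z.1 : ℕ) ^ (z.2 + 2)) - f ((z.1 : ℕ) ^ (z.2 + 1))) / (((z.1 : ℕ) ^ (z.2 + 2) : ℕ) : ℂ) ^ 2‖ ≤
      4 * (|K| + 1) * (∑' z, Wt l z) * x ^ (7/4 : ℝ) := by
  set g : Nat.Primes × ℕ → ℂ := fun z => f ((z.1 : ℕ) ^ (z.2 + 2)) - f ((z.1 : ℕ) ^ (z.2 + 1)) with hg
  set q : Nat.Primes × ℕ → ℕ := fun z => (z.1 : ℕ) ^ (z.2 + 2) with hq
  have hqpos : ∀ z, 0 < q z := fun z => pow_pos z.1.2.pos _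
  have hgb : ∀ z, ‖g z‖ ≤ 2 * (|K| + 1) * ((z.2 : ℝ) + 2) ^ l * (q z : ℝ) := fun z =>
    (g_bound f hp1 l K hK z.1 z.1.2 z.2).2
  have hWb : ∀ z : Nat.Primes × ℕ, ((z.2 : ℝ) + 2) ^ l * (q z : ℝ) ^ (-(3/4) : ℝ) ≤ Wt l z :=
    fun z => Wt_bound l z.1 z.2
  have hS : Summable (fun z => g z / (q z : ℂ) ^ 2) := by
    refine Summable.of_norm_bounded ((Wt_summable l).mul_left (2 * (|K| + 1))) fun z => ?_
    have hq0 : (0 : ℝ) < q z := by exact_mod_cast hqpos z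
    have hq1 : (1 : ℝ) ≤ q z := by exact_mod_cast hqpos z
    rw [norm_div, norm_pow, Complex.norm_natCast, div_le_iff₀ (by positivity)]
    refine (hgb z).trans ?_
    have h1 : (q z : ℝ) ≤ (q z : ℝ) ^ (-(3/4) : ℝ) * (q z : ℝ) ^ 2 := by
      rw [← Real.rpow_natCast, ← Real.rpow_add hq0]
      nth_rewrite 1 [← Real.rpow_one (q z : ℝ)]
      exact Real.rpow_le_rpow_of_exponent_le hq1 (by norm_num)
    calc 2 * (|K| + 1) * ((z.2 : ℝ) + 2) ^ l * (q z : ℝ)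
        ≤ 2 * (|K| + 1) * ((z.2 : ℝ) + 2) ^ l * ((q z : ℝ) ^ (-(3/4) : ℝ) * (q z : ℝ) ^ 2) := by
          gcongr
      _ = 2 * (|K| + 1) * (((z.2 : ℝ) + 2) ^ l * (q z : ℝ) ^ (-(3/4) : ℝ)) * (q z : ℝ) ^ 2 := by ring
      _ ≤ _ := by
          gcongr
          exact hWb z
  refine ⟨hS, fun x hx => ?_⟩
  have hx0 : 0 < x := by linarith
  have hbd : ∀ z, ‖g z * ((⌊x⌋₊ / q z : ℕ) : ℂ) ^ 2 - (x : ℂ) ^ 2 * (g z / (q z : ℂ) ^ 2)‖ ≤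
      4 * (|K| + 1) * x ^ (7/4 : ℝ) * Wt l z := by
    intro z
    have e : g z * ((⌊x⌋₊ / q z : ℕ) : ℂ) ^ 2 - (x : ℂ) ^ 2 * (g z / (q z : ℂ) ^ 2) =
        - (g z * ((x ^ 2 / (q z : ℝ) ^ 2 - ((⌊x⌋₊ / q z : ℕ) : ℝ) ^ 2 : ℝ) : ℂ)) := by
      push_cast; ring
    rw [e, norm_neg, norm_mul, Complex.norm_real, Real.norm_eq_abs]
    have h1 := (q_floor_bound x hx0 (q z) (hqpos z)).2
    calc _ ≤ (2 * (|K| + 1) * ((z.2 : ℝ) + 2) ^ l * (q z : ℝ)) *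
          |x ^ 2 / (q z : ℝ) ^ 2 - ((⌊x⌋₊ / q z : ℕ) : ℝ) ^ 2| := by
            gcongr
            exact hgb z
      _ = 2 * (|K| + 1) * ((z.2 : ℝ) + 2) ^ l * ((q z : ℝ) *
          |x ^ 2 / (q z : ℝ) ^ 2 - ((⌊x⌋₊ / q z : ℕ) : ℝ) ^ 2|) := by ring
      _ ≤ 2 * (|K| + 1) * ((z.2 : ℝ) + 2) ^ l * (2 * x ^ (7/4 : ℝ) * (q z : ℝ) ^ (-(3/4) : ℝ)) := by
            gcongr
      _ = 4 * (|K| + 1) * x ^ (7/4 : ℝ) * (((z.2 : ℝ) + 2) ^ l * (q z : ℝ) ^ (-(3/4) : ℝ)) := by ring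
      _ ≤ _ := by
            gcongr
            exact hWb z
  have hWs := (Wt_summable l).mul_left (4 * (|K| + 1) * x ^ (7/4 : ℝ))
  have hSd : Summable (fun z => g z * ((⌊x⌋₊ / q z : ℕ) : ℂ) ^ 2 - (x : ℂ) ^ 2 * (g z / (q z : ℂ) ^ 2)) :=
    Summable.of_norm_bounded hWs hbd
  have hS1 : Summable (fun z => g z * ((⌊x⌋₊ / q z : ℕ) : ℂ) ^ 2) :=
    (hSd.add (hS.mul_left ((x : ℂ) ^ 2))).congr fun z => by ring
  have hN : ∀ p : ℕ, p.Prime → ∀ k : ℕ, (⌊x⌋₊ < p ∨ ⌊x⌋₊ - 1 ≤ k) → ⌊x⌋₊ / p ^ (k + 2) = 0 := by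
    intro p hp k h
    apply Nat.div_eq_of_lt
    rcases h with h | h
    · exact h.trans_le (Nat.le_self_pow (by omega) p)
    · have := Nat.lt_pow_self hp.one_lt (n := k + 2)
      omega
  have hfin : ∑ p ∈ (Finset.Icc 1 ⌊x⌋₊).filter Nat.Prime, ∑ k ∈ Finset.range (⌊x⌋₊ - 1),
      (f (p ^ (k + 2)) - f (p ^ (k + 1))) * ((⌊x⌋₊ / p ^ (k + 2) : ℕ) : ℂ) ^ 2 =
      ∑' z, g z * ((⌊x⌋₊ / q z : ℕ) : ℂ) ^ 2 := by
    rw [finset_to_tsum (fun p => ∑ k ∈ Finset.range (⌊x⌋₊ - 1),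
      (f (p ^ (k + 2)) - f (p ^ (k + 1))) * ((⌊x⌋₊ / p ^ (k + 2) : ℕ) : ℂ) ^ 2)]
    · rw [hS1.tsum_prod]
      refine tsum_congr fun p => ?_
      rw [tsum_eq_sum (s := Finset.range (⌊x⌋₊ - 1))]
      intro k hk
      rw [Finset.mem_range, not_lt] at hk
      simp only [hq]
      rw [hN p p.2 k (Or.inr hk)]
      simp
    · intro p hp hpN
      refine Finset.sum_eq_zero fun k _ => ?_
      rw [hN p hp k (Or.inl hpN)]
      simp
  rw [hfin, ← tsum_mul_left, ← hS1.tsum_sub (hS.mul_left _)]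
  refine (tsum_of_norm_bounded hWs.hasSum hbd).trans (le_of_eq ?_)
  rw [tsum_mul_left]
  ring

lemma prime_part (x : ℝ) (hx : 1 ≤ x) :
    ‖∑ p ∈ (Finset.Icc 1 ⌊x⌋₊).filter Nat.Prime, (p : ℂ) * ((⌊x⌋₊ / p : ℕ) : ℂ) ^ 2 -
      ((x ^ 2 * bsum ⌊x⌋₊ : ℝ) : ℂ)‖ ≤ 2 * x * (Nat.primeCounting ⌊x⌋₊ : ℝ) := by
  have hcard : (Nat.primeCounting ⌊x⌋₊ : ℝ) = ∑ p ∈ (Finset.Icc 1 ⌊x⌋₊).filter Nat.Prime, (1 : ℝ) := by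
    rw [Finset.sum_const, nsmul_eq_mul, mul_one, Nat.primeCounting, Nat.primeCounting',
      Nat.count_eq_card_filter_range]
    congr 2
    ext p
    simp only [Finset.mem_filter, Finset.mem_range, Finset.mem_Icc]
    constructor
    · rintro ⟨h1, h2⟩
      exact ⟨⟨h2.pos, by omega⟩, h2⟩
    · rintro ⟨⟨h0, h1⟩, h2⟩
      exact ⟨by omega, h2⟩
  rw [hcard, Finset.mul_sum, bsum, ← Finset.sum_filter, Finset.mul_sum, Complex.ofReal_sum,
    ← Finset.sum_sub_distrib]
  refine norm_sum_le_of_le _ fun p hp => ?_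
  have hpp := (Finset.mem_filter.1 hp).2
  have hp0 : (p : ℝ) ≠ 0 := by exact_mod_cast hpp.ne_zero
  have e : (p : ℂ) * ((⌊x⌋₊ / p : ℕ) : ℂ) ^ 2 - ((x ^ 2 * (1 / p) : ℝ) : ℂ) =
      - ((p * (x ^ 2 / (p : ℝ) ^ 2 - ((⌊x⌋₊ / p : ℕ) : ℝ) ^ 2) : ℝ) : ℂ) := by
    have : x ^ 2 * (1 / p) = p * (x ^ 2 / (p : ℝ) ^ 2) := by field_simp
    rw [this]
    push_cast
    ring
  rw [e, norm_neg, Complex.norm_real, Real.norm_eq_abs, abs_mul, Nat.abs_cast, mul_one]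
  exact (q_floor_bound x (by linarith) p hpp.pos).1

/-- **Two-variable gcd sums for the class `F₁`** (Theorem `Th_f_additive_gcd_1`, case `k = 2`).
`F₁` is the class of additive `f : ℕ → ℂ` with `f p = p` for every prime `p` and
`|f (p^ν)| ≤ K ν^ℓ p^ν` uniformly for primes `p` and `ν ≥ 2`. For such `f`:
`Σ_{n₁,n₂ ≤ x} f (gcd(n₁,n₂)) = x² log log x + D̄_{f,2} x² + O(x²/log x)`, where
`D̄_{f,2} = γ + Σ_p (log(1 − 1/p) + (1 − 1/p²) Σ_{ν ≥ 1} f(p^ν)/p^{2ν})`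
(absolutely convergent sum over primes). -/
theorem stmt_14 (f : ℕ → ℂ)
    (hadd : ∀ m n : ℕ, Nat.Coprime m n → f (m * n) = f m + f n)
    (hp1 : ∀ p : ℕ, p.Prime → f p = (p : ℂ))
    (hbound : ∃ (l : ℕ) (K : ℝ), ∀ p : ℕ, p.Prime → ∀ ν : ℕ, 2 ≤ ν →
      ‖f (p ^ ν)‖ ≤ K * (ν : ℝ) ^ l * (p : ℝ) ^ ν) :
    Summable (fun p : Nat.Primes =>
      ‖(Real.log (1 - 1 / ((p : ℕ) : ℝ)) : ℂ) +
        (1 - 1 / ((p : ℕ) : ℂ) ^ 2) *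
          ∑' ν : ℕ, f ((p : ℕ) ^ (ν + 1)) / ((p : ℕ) : ℂ) ^ (2 * (ν + 1))‖) ∧
    ∃ c > (0 : ℝ), ∃ x₀ : ℝ, 3 ≤ x₀ ∧ ∀ x ≥ x₀,
      ‖(∑ n₁ ∈ Finset.Icc 1 ⌊x⌋₊, ∑ n₂ ∈ Finset.Icc 1 ⌊x⌋₊, f (Nat.gcd n₁ n₂)) -
        (((x ^ 2 * Real.log (Real.log x) : ℝ) : ℂ) +
          ((Real.eulerMascheroniConstant : ℂ) +
            ∑' p : Nat.Primes,
              ((Real.log (1 - 1 / ((p : ℕ) : ℝ)) : ℂ) +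
                (1 - 1 / ((p : ℕ) : ℂ) ^ 2) *
                  ∑' ν : ℕ, f ((p : ℕ) ^ (ν + 1)) / ((p : ℕ) : ℂ) ^ (2 * (ν + 1)))) *
            (x : ℂ) ^ 2)‖ ≤
        c * x ^ 2 / Real.log x := by
  obtain ⟨l, K, hK⟩ := hbound
  obtain ⟨hTs, hT⟩ := higher f hp1 l K hK
  set T : Nat.Primes × ℕ → ℂ := fun z =>
    (f ((z.1 : ℕ) ^ (z.2 + 2)) - f ((z.1 : ℕ) ^ (z.2 + 1))) / (((z.1 : ℕ) ^ (z.2 + 2) : ℕ) : ℂ) ^ 2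
    with hTdef
  have hterm : ∀ p : Nat.Primes, (Real.log (1 - 1 / ((p : ℕ) : ℝ)) : ℂ) +
        (1 - 1 / ((p : ℕ) : ℂ) ^ 2) *
          ∑' ν : ℕ, f ((p : ℕ) ^ (ν + 1)) / ((p : ℕ) : ℂ) ^ (2 * (ν + 1)) =
      ((Real.log (1 - 1 / ((p : ℕ) : ℝ)) + 1 / ((p : ℕ) : ℝ) : ℝ) : ℂ) + ∑' k, T (p, k) := by
    intro p
    rw [term_eq f hadd hp1 l K hK p p.2]
    change _ + (1 / ((p : ℕ) : ℂ) + ∑' k, T (p, k)) = _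
    rw [Complex.ofReal_add, Complex.ofReal_div, Complex.ofReal_one, Complex.ofReal_natCast,
      add_assoc]
  have hTp : Summable (fun p : Nat.Primes => ‖∑' k, T (p, k)‖) := by
    have hn := hTs.norm
    refine Summable.of_nonneg_of_le (fun _ => norm_nonneg _) (fun p => ?_) hn.prod
    exact norm_tsum_le_tsum_norm (hn.prod_factor p)
  have hSc : Summable (fun p : Nat.Primes =>
      ((Real.log (1 - 1 / ((p : ℕ) : ℝ)) + 1 / ((p : ℕ) : ℝ) : ℝ) : ℂ)) :=
    Complex.ofRealCLM.summable summable_S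
  simp_rw [hterm]
  constructor
  · refine Summable.of_nonneg_of_le (fun _ => norm_nonneg _) (fun p => norm_add_le _ _)
      (hSc.norm.add hTp)
  rw [hSc.tsum_add hTp.of_norm, ← hTs.tsum_prod, ← Complex.ofReal_tsum]
  obtain ⟨C, hC0, hC⟩ := mertens
  set M := ∑' p : Nat.Primes, (Real.log (1 - 1 / ((p : ℕ) : ℝ)) + 1 / ((p : ℕ) : ℝ)) with hM
  obtain ⟨x₁, hx₁⟩ := Filter.eventually_atTop.1 (Chebyshev.eventually_primeCounting_le one_pos)
  set W := ∑' z, Wt l z with hW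
  have hW0 : 0 ≤ W := tsum_nonneg (Wt_nonneg l)
  have hl4 : 0 ≤ Real.log 4 := Real.log_nonneg (by norm_num)
  refine ⟨2 * (Real.log 4 + 1) + C + 16 * (|K| + 1) * W, by positivity, max x₁ 3, le_max_right _ _,
    fun x hx => ?_⟩
  have hx3 : 3 ≤ x := (le_max_right _ _).trans hx
  have hxx := hx₁ x ((le_max_left _ _).trans hx)
  have hx0 : 0 < x := by linarith
  have hlog : 0 < Real.log x := Real.log_pos (by linarith)
  have hN : 1 ≤ ⌊x⌋₊ := Nat.le_floor (by push_cast; linarith)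
  have B1 := prime_part x (by linarith)
  have B2 := hC x (by linarith)
  have B3 := hT x (by linarith)
  rw [S_eq f hadd]
  have hsplit : ∑ p ∈ (Finset.Icc 1 ⌊x⌋₊).filter Nat.Prime, ∑ k ∈ Finset.range ⌊x⌋₊,
      (f (p ^ (k + 1)) - f (p ^ k)) * ((⌊x⌋₊ / p ^ (k + 1) : ℕ) : ℂ) ^ 2 =
      ∑ p ∈ (Finset.Icc 1 ⌊x⌋₊).filter Nat.Prime, (p : ℂ) * ((⌊x⌋₊ / p : ℕ) : ℂ) ^ 2 +
      ∑ p ∈ (Finset.Icc 1 ⌊x⌋₊).filter Nat.Prime, ∑ k ∈ Finset.range (⌊x⌋₊ - 1),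
      (f (p ^ (k + 2)) - f (p ^ (k + 1))) * ((⌊x⌋₊ / p ^ (k + 2) : ℕ) : ℂ) ^ 2 := by
    rw [← Finset.sum_add_distrib]
    refine Finset.sum_congr rfl fun p hp => ?_
    obtain ⟨m, hm⟩ : ∃ m, ⌊x⌋₊ = m + 1 := ⟨⌊x⌋₊ - 1, by omega⟩
    rw [hm, Finset.sum_range_succ', add_comm, Nat.add_sub_cancel]
    congr 1
    simp [f_one f hadd, hp1 p (Finset.mem_filter.1 hp).2]
  rw [hsplit]
  set A1 := ∑ p ∈ (Finset.Icc 1 ⌊x⌋₊).filter Nat.Prime, (p : ℂ) * ((⌊x⌋₊ / p : ℕ) : ℂ) ^ 2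
  set A2 := ∑ p ∈ (Finset.Icc 1 ⌊x⌋₊).filter Nat.Prime, ∑ k ∈ Finset.range (⌊x⌋₊ - 1),
      (f (p ^ (k + 2)) - f (p ^ (k + 1))) * ((⌊x⌋₊ / p ^ (k + 2) : ℕ) : ℂ) ^ 2
  have e : A1 + A2 - (((x ^ 2 * Real.log (Real.log x) : ℝ) : ℂ) +
      ((Real.eulerMascheroniConstant : ℂ) + ((M : ℂ) + ∑' z, T z)) * (x : ℂ) ^ 2) =
      (A1 - ((x ^ 2 * bsum ⌊x⌋₊ : ℝ) : ℂ)) +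
      ((x ^ 2 * (bsum ⌊x⌋₊ - Real.log (Real.log x) - (Real.eulerMascheroniConstant + M)) : ℝ) : ℂ) +
      (A2 - (x : ℂ) ^ 2 * ∑' z, T z) := by
    push_cast
    ring
  rw [e]
  have c1 : 2 * x * (Nat.primeCounting ⌊x⌋₊ : ℝ) ≤ 2 * (Real.log 4 + 1) * x ^ 2 / Real.log x := by
    refine (mul_le_mul_of_nonneg_left hxx (by positivity)).trans (le_of_eq ?_)
    ring
  have c2 : ‖((x ^ 2 * (bsum ⌊x⌋₊ - Real.log (Real.log x) -
      (Real.eulerMascheroniConstant + M)) : ℝ) : ℂ)‖ ≤ C * x ^ 2 / Real.log x := by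
    rw [Complex.norm_real, Real.norm_eq_abs, abs_mul, abs_of_nonneg (by positivity : 0 ≤ x ^ 2)]
    refine (mul_le_mul_of_nonneg_left B2 (by positivity)).trans (le_of_eq ?_)
    ring
  have c3 : x ^ (7/4 : ℝ) ≤ 4 * x ^ 2 / Real.log x := by
    rw [le_div_iff₀ hlog]
    have h1 := Real.log_le_rpow_div hx0.le (ε := 1/4) (by norm_num)
    have h2 : x ^ 2 = x ^ (7/4 : ℝ) * x ^ (1/4 : ℝ) := by
      rw [← Real.rpow_add hx0]; norm_num
    rw [h2]
    have h3 : 0 ≤ x ^ (7/4 : ℝ) := by positivity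
    calc _ ≤ x ^ (7/4 : ℝ) * (x ^ (1/4 : ℝ) / (1/4)) := mul_le_mul_of_nonneg_left h1 h3
      _ = _ := by ring
  have c4 : 4 * (|K| + 1) * W * x ^ (7/4 : ℝ) ≤ 16 * (|K| + 1) * W * x ^ 2 / Real.log x := by
    refine (mul_le_mul_of_nonneg_left c3 (by positivity)).trans (le_of_eq ?_)
    ring
  refine (norm_add₃_le).trans ((add_le_add (add_le_add (B1.trans c1) c2) (B3.trans c4)).trans
    (le_of_eq ?_))
  ring
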